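/- arXiv:1303.4501 — 4 statements merged into one kernel-verified Lean document; each statement's English description precedes it below -/
import Mathlib

section
/- Let p be a prime, let n ≥ 1, and let G be a permutation group acting transitively on a finite set Ω of cardinality p^n. Then G contains a non-identity semiregular element. -/
/-- An element `g` of a group acting on `Ω` is semiregular if no non-identity element
of the cyclic group generated by `g` fixes a point. -/
def IsSemiregularElt {G : Type*} [Group G] (Ω : Type*) [MulAction G Ω] (g : G) : Prop :=
  ∀ n : ℤ, (∃ x : Ω, g ^ n • x = x) → g ^ n = 1

/-- A Sylow `p`-subgroup of a group acting transitively on a set of `p`-power cardinality is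
itself transitive. -/
theorem Sylow.isPretransitive_of_card_eq_pow {G X : Type*} [Group G] [Finite G] [MulAction G X]
    [MulAction.IsPretransitive G X] [Finite X] {p n : ℕ} [Fact p.Prime]
    (hX : Nat.card X = p ^ n) (P : Sylow p G) : MulAction.IsPretransitive P X := by
  have hpos : 0 < Nat.card X := hX ▸ pow_pos (Fact.out : p.Prime).pos n
  obtain ⟨x⟩ := (Nat.card_pos_iff.1 hpos).1
  refine (MulAction.isPretransitive_iff_orbit_eq_univ x).2 ?_
  have hdvd : p ^ n ∣ (MulAction.stabilizer G x).relIndex P * (P : Subgroup G).index := by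
    rw [← Subgroup.inf_relIndex_right, Subgroup.relIndex_mul_index inf_le_right, ← hX,
      ← MulAction.index_stabilizer_of_transitive G x]
    exact Subgroup.index_dvd_of_le inf_le_left
  have hcop : Nat.Coprime (p ^ n) (P : Subgroup G).index :=
    Nat.Coprime.pow_left n (((Fact.out : p.Prime).coprime_iff_not_dvd).2 P.not_dvd_index)
  have horbit : (MulAction.stabilizer G x).relIndex P = (MulAction.orbit P x).ncard :=
    MulAction.index_stabilizer P x
  have hle : p ^ n ≤ (MulAction.orbit P x).ncard := by
    rw [← horbit]
    exact Nat.le_of_dvd (Nat.pos_of_ne_zero Subgroup.FiniteIndex.index_ne_zero)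
      (hcop.dvd_of_dvd_mul_right hdvd)
  refine Set.eq_of_subset_of_ncard_le (Set.subset_univ _) ?_
  rwa [Set.ncard_univ, hX]

/-- A central element of a transitive group that fixes a point fixes every point. -/
theorem MulAction.smul_eq_of_mem_center {G X : Type*} [Group G] [MulAction G X]
    [MulAction.IsPretransitive G X] {z : G} (hz : z ∈ Subgroup.center G) {x : X}
    (hx : z • x = x) (y : X) : z • y = y := by
  obtain ⟨g, rfl⟩ := MulAction.exists_smul_eq G x y
  rw [smul_smul, ← Subgroup.mem_center_iff.1 hz g, mul_smul, hx]

/-- A transitive permutation group of prime-power degree `p ^ n`, `n ≥ 1`, contains a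
non-identity semiregular element. -/
theorem semiregular_of_primePower_degree {Ω : Type*} [Fintype Ω] (p n : ℕ)
    (hp : p.Prime) (hn : 1 ≤ n) (hΩ : Fintype.card Ω = p ^ n)
    (G : Subgroup (Equiv.Perm Ω))
    (htrans : ∀ x y : Ω, ∃ g ∈ G, g x = y) :
    ∃ g ∈ G, g ≠ 1 ∧ IsSemiregularElt Ω g := by
  have : Fact p.Prime := ⟨hp⟩
  have hcard : Nat.card Ω = p ^ n := by rw [Nat.card_eq_fintype_card, hΩ]
  have : MulAction.IsPretransitive G Ω := ⟨fun x y => by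
    obtain ⟨g, hg, hgx⟩ := htrans x y
    exact ⟨⟨g, hg⟩, hgx⟩⟩
  obtain ⟨P⟩ : Nonempty (Sylow p G) := inferInstance
  have : MulAction.IsPretransitive P Ω := P.isPretransitive_of_card_eq_pow hcard
  have : Nontrivial Ω := by
    rw [← Finite.one_lt_card_iff_nontrivial, hcard]
    exact Nat.one_lt_pow (by omega) hp.one_lt
  have : Nontrivial P := by
    obtain ⟨x, y, hxy⟩ := exists_pair_ne Ω
    obtain ⟨g, hg⟩ := MulAction.exists_smul_eq P x y
    exact ⟨g, 1, fun h => hxy (by rw [← hg, h, one_smul])⟩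
  have : Nontrivial (Subgroup.center P) := P.isPGroup'.center_nontrivial
  obtain ⟨z, hz⟩ := exists_ne (1 : Subgroup.center P)
  refine ⟨((z : P) : G), ((z : P) : G).2, fun h => hz ?_, fun m => ?_⟩
  · exact Subtype.ext (Subtype.ext (Subtype.ext h))
  · rintro ⟨x, hx⟩
    have hfix : ((z : P) ^ m) • x = x := by simpa [Subgroup.smul_def] using hx
    ext y
    simpa [Subgroup.smul_def] using
      MulAction.smul_eq_of_mem_center (Subgroup.zpow_mem _ z.2 m) hfix y
end

section
/- Let G be a permutation group acting transitively on a finite set Ω, and let N be a non-trivial abelian normal subgroup of G whose action on Ω has at most two orbits. Then N contains a non-identity semiregular element. -/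
/-- In a commutative family of permutations, an element fixing `n x` also fixes `x`. -/
theorem Equiv.Perm.apply_eq_of_commute_of_apply_apply_eq {Ω : Type*} {a n : Equiv.Perm Ω}
    (h : a * n = n * a) {x : Ω} (hx : a (n x) = n x) : a x = x := by
  rw [← Equiv.Perm.mul_apply, h, Equiv.Perm.mul_apply] at hx
  exact n.injective hx

/-- If a transitive permutation group `G` has a non-trivial abelian normal subgroup `N`
with at most two orbits, then `N` contains a non-identity semiregular element. -/
theorem semiregular_of_abelian_normal_two_orbits {Ω : Type*} [Fintype Ω]
    (G N : Subgroup (Equiv.Perm Ω))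
    (htrans : ∀ x y : Ω, ∃ g ∈ G, g x = y)
    (hNG : N ≤ G)
    (hnormal : ∀ g ∈ G, ∀ n ∈ N, g * n * g⁻¹ ∈ N)
    (habelian : ∀ a ∈ N, ∀ b ∈ N, a * b = b * a)
    (hnontrivial : N ≠ ⊥)
    (horbits : ∃ x y : Ω, ∀ z : Ω, (∃ n ∈ N, n x = z) ∨ (∃ n ∈ N, n y = z)) :
    ∃ g ∈ N, g ≠ 1 ∧ IsSemiregularElt Ω g := by
  obtain ⟨x, y, hxy⟩ := horbits
  obtain ⟨g, hg, hgx⟩ := htrans x y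
  have fixes_of_fixes : ∀ a ∈ N, ∀ z, a z = z → a x = x ∨ a y = y := by
    intro a ha z hz
    rcases hxy z with ⟨n, hn, rfl⟩ | ⟨n, hn, rfl⟩
    · exact .inl (Equiv.Perm.apply_eq_of_commute_of_apply_apply_eq (habelian a ha n hn) hz)
    · exact .inr (Equiv.Perm.apply_eq_of_commute_of_apply_apply_eq (habelian a ha n hn) hz)
  have eq_one : ∀ a ∈ N, a x = x → a y = y → a = 1 := by
    intro a ha hax hay
    ext z
    rcases hxy z with ⟨n, hn, rfl⟩ | ⟨n, hn, rfl⟩ <;>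
      rw [← Equiv.Perm.mul_apply, habelian a ha n hn, Equiv.Perm.mul_apply] <;> simp [hax, hay]
  by_cases hK : ∃ k ∈ N, k x = x ∧ k ≠ 1
  · obtain ⟨k, hk, hkx, hk1⟩ := hK
    have hgy : g⁻¹ y = x := by rw [Equiv.Perm.inv_eq_iff_eq, hgx]
    have hl : g * k * g⁻¹ ∈ N := hnormal g hg k hk
    have hly : (g * k * g⁻¹) y = y := by simp [Equiv.Perm.mul_apply, hgy, hkx, hgx]
    have hpow : ∀ m : ℤ, (g * k * g⁻¹) ^ m = 1 ↔ k ^ m = 1 := fun m => by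
      rw [conj_zpow, conj_eq_one_iff]
    generalize g * k * g⁻¹ = l at hl hly hpow
    have hmul : ∀ m : ℤ, (k * l) ^ m = k ^ m * l ^ m := Commute.mul_zpow (habelian k hk l hl)
    have hkm : ∀ m : ℤ, (k ^ m) x = x := Equiv.Perm.zpow_apply_eq_self_of_apply_eq_self hkx
    have hlm : ∀ m : ℤ, (l ^ m) y = y := Equiv.Perm.zpow_apply_eq_self_of_apply_eq_self hly
    have pow_left_eq_one : ∀ m : ℤ, ((k * l) ^ m) x = x ∨ ((k * l) ^ m) y = y → k ^ m = 1 := by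
      rintro m (h | h) <;> rw [hmul] at h
      · rw [← hpow]
        refine eq_one _ (N.zpow_mem hl m) ?_ (hlm m)
        apply (k ^ m).injective
        rw [hkm, ← Equiv.Perm.mul_apply, h]
      · rw [Equiv.Perm.mul_apply, hlm] at h
        exact eq_one _ (N.zpow_mem hk m) (hkm m) h
    refine ⟨k * l, N.mul_mem hk hl, fun h => hk1 ?_, ?_⟩
    · simpa using pow_left_eq_one 1 (.inl (by simp [h]))
    · rintro m ⟨z, hz⟩
      have hm := pow_left_eq_one m (fixes_of_fixes _ (N.zpow_mem (N.mul_mem hk hl) m) z hz)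
      rw [hmul, hm, (hpow m).2 hm, one_mul]
  · push Not at hK
    obtain ⟨n, hn, hn1⟩ := N.bot_or_exists_ne_one.resolve_left hnontrivial
    refine ⟨n, hn, hn1, ?_⟩
    rintro m ⟨z, hz⟩
    have hm := N.zpow_mem hn m
    rcases fixes_of_fixes _ hm z hz with h | h
    · exact hK _ hm h
    · have hc := hK _ (hnormal g⁻¹ (G.inv_mem hg) _ hm) (by
        rw [inv_inv, Equiv.Perm.mul_apply, Equiv.Perm.mul_apply, hgx, h,
          Equiv.Perm.inv_eq_iff_eq, hgx])
      exact conj_eq_one_iff.1 hc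
end

section
/- Let G be a permutation group on a finite set Ω and let K be a normal subgroup of G such that the induced action of G/K on the set of K-orbits on Ω is faithful. Suppose G/K contains an element gK which acts semiregularly and non-trivially on the set of K-orbits and whose order is coprime to |K|. Then G contains a semiregular element of order equal to the order of gK. -/
/-- Let `G` be a permutation group on a finite set `Ω` (a group acting faithfully on `Ω`)
and let `K` be a normal subgroup of `G` such that `G/K` acts faithfully on the set of
`K`-orbits.  If `gK ∈ G/K` is non-trivial, acts semiregularly on the set of `K`-orbits
(no non-identity power of `gK` fixes a `K`-orbit) and has order coprime to `|K|`, then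
`G` contains a semiregular element of order `|gK|`. -/
theorem semiregular_lift_of_coprime {G Ω : Type*} [Group G] [Finite Ω]
    [MulAction G Ω] [FaithfulSMul G Ω]
    (K : Subgroup G) [K.Normal]
    (hfaithful : ∀ g : G, (∀ x : Ω, g • x ∈ MulAction.orbit K x) → g ∈ K)
    (g : G)
    (hnt : (g : G ⧸ K) ≠ 1)
    (hsemi : ∀ m : ℤ, (∃ x : Ω, g ^ m • x ∈ MulAction.orbit K x) → g ^ m ∈ K)
    (hcoprime : Nat.Coprime (orderOf (g : G ⧸ K)) (Nat.card K)) :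
    ∃ h : G, orderOf h = orderOf (g : G ⧸ K) ∧ IsSemiregularElt Ω h := by
  have hpow : (g ^ Nat.card K) ^ orderOf (g : G ⧸ K) = 1 := by
    have hmem : g ^ orderOf (g : G ⧸ K) ∈ K := by
      rw [← QuotientGroup.eq_one_iff, QuotientGroup.mk_pow, pow_orderOf_eq_one]
    rw [pow_right_comm]
    exact congrArg Subtype.val (pow_card_eq_one' (x := (⟨_, hmem⟩ : K)))
  refine ⟨g ^ Nat.card K, Nat.dvd_antisymm (orderOf_dvd_of_pow_eq_one hpow) ?_, ?_⟩
  · rw [← hcoprime.orderOf_pow, ← QuotientGroup.mk_pow]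
    exact orderOf_map_dvd (QuotientGroup.mk' K) _
  · rintro m ⟨x, hx⟩
    have hgm : (g ^ Nat.card K) ^ m = g ^ ((Nat.card K : ℤ) * m) := by
      rw [zpow_mul, zpow_natCast]
    have hmem : g ^ ((Nat.card K : ℤ) * m) ∈ K :=
      hsemi _ ⟨x, by rw [← hgm, hx]; exact MulAction.mem_orbit_self x⟩
    rw [← QuotientGroup.eq_one_iff, QuotientGroup.mk_zpow, ← orderOf_dvd_iff_zpow_eq_one] at hmem
    obtain ⟨c, rfl⟩ := (Nat.isCoprime_iff_coprime.mpr hcoprime).dvd_of_dvd_mul_left hmem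
    rw [zpow_mul, zpow_natCast, hpow, one_zpow]
end

section
/- Let Γ⃗ be a finite digraph that is asymmetric (if (u,v) is an arc then (v,u) is not an arc), connected (the symmetrisation of the arc relation is connected), arc-transitive (Aut(Γ⃗) acts transitively on the non-empty set of arcs), and of out-valence 4 (every vertex has exactly 4 out-neighbours). Then Γ⃗ has a non-identity semiregular automorphism. -/
theorem norm_eq_one_of_isIntegral_average {ι : Type*} [Fintype ι] (f : ι → ℂ) {n : ℕ} (hn : n ≠ 0)
    (hf : ∀ i, f i ^ n = 1) (hint : IsIntegral ℤ ((∑ i, f i) / Fintype.card ι))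
    (hne : ∑ i, f i ≠ 0) : ‖(∑ i, f i) / Fintype.card ι‖ = 1 := by
  classical
  have hι : (0 : ℝ) < Fintype.card ι := by
    rcases isEmpty_or_nonempty ι with h | h
    · simp at hne
    · exact_mod_cast Fintype.card_pos
  have bound : ∀ g : ι → ℂ, (∀ i, g i ^ n = 1) → ‖(∑ i, g i) / Fintype.card ι‖ ≤ 1 := by
    intro g hg
    rw [norm_div, Complex.norm_natCast, div_le_one hι]
    refine (norm_sum_le _ _).trans ?_
    simp [fun i => Complex.norm_eq_one_of_pow_eq_one (hg i) hn]
  let K : IntermediateField ℚ ℂ := IntermediateField.adjoin ℚ (Set.range f)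
  have : FiniteDimensional ℚ K := by
    refine IntermediateField.finiteDimensional_adjoin (S := Set.range f) ?_
    rintro _ ⟨i, rfl⟩
    exact IsIntegral.of_pow (Nat.pos_of_ne_zero hn) (by rw [hf i]; exact isIntegral_one)
  let g : ι → K := fun i => ⟨f i, IntermediateField.subset_adjoin ℚ _ ⟨i, rfl⟩⟩
  let α : K := (∑ i, g i) / Fintype.card ι
  have hg : ∀ i, g i ^ n = 1 := fun i => Subtype.ext (by simpa [g] using hf i)
  have hα : algebraMap K ℂ α = (∑ i, f i) / Fintype.card ι := by
    simp [α, g]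
  have hαint : IsIntegral ℤ α := by
    rw [← isIntegral_algebraMap_iff (algebraMap K ℂ).injective, hα]
    exact hint
  have hα0 : α ≠ 0 := by
    intro h
    rw [h, map_zero, eq_comm, div_eq_zero_iff] at hα
    rcases hα with h | h
    · exact hne h
    · exact hι.ne' (by exact_mod_cast h)
  obtain ⟨N, hN⟩ := IsIntegrallyClosed.isIntegral_iff.1 (Algebra.isIntegral_norm ℚ hαint)
  have hN0 : N ≠ 0 := by
    rintro rfl
    exact hα0 (Algebra.norm_eq_zero_iff.1 (by rw [← hN]; simp))
  have hprod := Algebra.norm_eq_prod_embeddings ℚ ℂ α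
  rw [← hN] at hprod
  refine le_antisymm (bound f hf) ?_
  rw [← hα]
  have h1 : (1 : ℝ) ≤ ‖(N : ℂ)‖ := by
    rw [Complex.norm_intCast]
    exact_mod_cast Int.one_le_abs hN0
  have h2 : ‖(N : ℂ)‖ = ∏ σ : K →ₐ[ℚ] ℂ, ‖σ α‖ := by
    rw [← norm_prod, ← hprod]
    simp
  rw [h2, ← Finset.mul_prod_erase _ _ (Finset.mem_univ (IsScalarTower.toAlgHom ℚ K ℂ))] at h1
  refine h1.trans ?_
  refine mul_le_of_le_one_right (norm_nonneg _) ?_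
  refine Finset.prod_le_one (fun _ _ => norm_nonneg _) fun σ _ => ?_
  have := bound (fun i => σ (g i)) fun i => by rw [← map_pow, hg, map_one]
  simpa [α] using this

theorem eq_of_isIntegral_average {ι : Type*} [Fintype ι] (f : ι → ℂ) {n : ℕ} (hn : n ≠ 0)
    (hf : ∀ i, f i ^ n = 1) (hint : IsIntegral ℤ ((∑ i, f i) / Fintype.card ι))
    (hne : ∑ i, f i ≠ 0) (j : ι) : f j = (∑ i, f i) / Fintype.card ι := by
  have hα := norm_eq_one_of_isIntegral_average f hn hf hint hne
  set α := (∑ i, f i) / Fintype.card ι with hαdef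
  have hι : (Fintype.card ι : ℂ) ≠ 0 := by
    have : Nonempty ι := ⟨j⟩
    exact_mod_cast Fintype.card_ne_zero
  have hsum : ∑ i, f i = Fintype.card ι * α := by rw [hαdef]; field_simp
  have hnorm : ∀ i, ‖f i‖ = 1 := fun i => Complex.norm_eq_one_of_pow_eq_one (hf i) hn
  have hαα : α * (starRingEnd ℂ) α = 1 := by
    rw [Complex.mul_conj, Complex.normSq_eq_norm_sq, hα]; simp
  have hle : ∀ i, 0 ≤ 1 - (f i * (starRingEnd ℂ) α).re := fun i => by
    have := Complex.re_le_norm (f i * (starRingEnd ℂ) α)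
    rw [norm_mul, hnorm, RCLike.norm_conj, hα] at this
    linarith
  have hzero : ∑ i, (1 - (f i * (starRingEnd ℂ) α).re) = 0 := by
    rw [Finset.sum_sub_distrib, ← Complex.re_sum, ← Finset.sum_mul, hsum, mul_assoc, hαα]
    simp
  have hj := (Finset.sum_eq_zero_iff_of_nonneg fun i _ => hle i).1 hzero j (Finset.mem_univ j)
  have h1 : f j * (starRingEnd ℂ) α = 1 := by
    have hn1 : ‖f j * (starRingEnd ℂ) α‖ = 1 := by
      rw [norm_mul, hnorm, RCLike.norm_conj, hα, one_mul]
    have hsq := Complex.sq_norm (f j * (starRingEnd ℂ) α)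
    rw [hn1, Complex.normSq_apply] at hsq
    have hre : (f j * (starRingEnd ℂ) α).re = 1 := by linarith
    rw [hre] at hsq
    refine Complex.ext (by simp [hre]) ?_
    have := mul_self_eq_zero.1 (by linarith :
      (f j * (starRingEnd ℂ) α).im * (f j * (starRingEnd ℂ) α).im = 0)
    rw [this, Complex.one_im]
  calc f j = f j * (α * (starRingEnd ℂ) α) := by rw [hαα, mul_one]
    _ = (f j * (starRingEnd ℂ) α) * α := by ring
    _ = α := by rw [h1, one_mul]

open Polynomial in
theorem Matrix.pow_eq_one_of_mem_roots_charpoly {d n : ℕ} {M : Matrix (Fin d) (Fin d) ℂ}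
    (hM : M ^ n = 1) {z : ℂ} (hz : z ∈ M.charpoly.roots) : z ^ n = 1 := by
  have hd : Nontrivial (Matrix (Fin d) (Fin d) ℂ) := by
    rcases d with _ | d
    · simp at hz
    · infer_instance
  have hspec : z ∈ spectrum ℂ M :=
    Matrix.mem_spectrum_iff_isRoot_charpoly.2 (Polynomial.isRoot_of_mem_roots hz)
  have h := spectrum.subset_polynomial_aeval M (X ^ n : ℂ[X]) ⟨z, hspec, rfl⟩
  simpa [hM, spectrum.one_eq] using h

theorem Matrix.isIntegral_trace_of_pow_eq_one {d n : ℕ} {M : Matrix (Fin d) (Fin d) ℂ}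
    (hn : n ≠ 0) (hM : M ^ n = 1) : IsIntegral ℤ M.trace := by
  rw [Matrix.trace_eq_sum_roots_charpoly]
  refine IsIntegral.multiset_sum fun z hz => ?_
  exact IsIntegral.of_pow (Nat.pos_of_ne_zero hn)
    (by rw [Matrix.pow_eq_one_of_mem_roots_charpoly hM hz]; exact isIntegral_one)

open Polynomial in
theorem Matrix.eq_scalar_of_isIntegral_trace_div {d n : ℕ} {M : Matrix (Fin d) (Fin d) ℂ}
    (hn : n ≠ 0) (hM : M ^ n = 1) (htr : M.trace ≠ 0) (hint : IsIntegral ℤ (M.trace / d)) :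
    ∃ z : ℂ, M = Matrix.scalar (Fin d) z := by
  set s := M.charpoly.roots with hs
  have hcard : s.card = d := by
    rw [hs, ← (IsAlgClosed.splits M.charpoly).natDegree_eq_card_roots,
      M.charpoly_natDegree_eq_dim, Fintype.card_fin]
  have hsum : ∑ i : s, (i : ℂ) = M.trace := by
    rw [Matrix.trace_eq_sum_roots_charpoly, ← hs]
    exact congrArg Multiset.sum (Multiset.map_univ_coe s)
  set z := M.trace / d with hz
  have hroots : ∀ x ∈ s, x = z := by
    intro x hx
    have := eq_of_isIntegral_average (fun i : s => (i : ℂ)) hn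
      (fun i => Matrix.pow_eq_one_of_mem_roots_charpoly hM (Multiset.coe_mem (x := i)))
      (by rw [hsum, Multiset.card_coe, hcard]; exact hint) (by rw [hsum]; exact htr)
      ⟨x, ⟨0, Multiset.count_pos.2 hx⟩⟩
    rwa [hsum, Multiset.card_coe, hcard] at this
  have hchar : M.charpoly = (X - C z) ^ d := by
    rw [(IsAlgClosed.splits M.charpoly).eq_prod_roots_of_monic M.charpoly_monic, ← hs,
      Multiset.eq_replicate.2 ⟨hcard, hroots⟩]
    simp
  have hd : d ≠ 0 := by
    rintro rfl
    simp at htr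
  have hzn : z ^ n = 1 := by
    obtain ⟨x, hx⟩ := Multiset.card_pos_iff_exists_mem.1 (by omega : 0 < s.card)
    rw [← hroots x hx]
    exact Matrix.pow_eq_one_of_mem_roots_charpoly hM hx
  obtain ⟨h, hh⟩ : X - C z ∣ (X ^ n - 1 : ℂ[X]) := by
    rw [dvd_iff_isRoot]
    simp [hzn]
  have hsep : (X ^ n - 1 : ℂ[X]).Separable := by
    have := Polynomial.separable_X_pow_sub_C (1 : ℂ) (n := n) (by exact_mod_cast hn) one_ne_zero
    simpa using this
  rw [hh] at hsep
  obtain ⟨a, b, hab⟩ := hsep.isCoprime.pow_left (m := d)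
  have hMz : aeval M ((X - C z) ^ d) = 0 := by
    rw [← hchar]
    exact Matrix.aeval_self_charpoly M
  have hh0 : aeval M (h * (X - C z)) = 0 := by
    rw [mul_comm, ← hh]
    simp [hM]
  have h1 : aeval M (X - C z) = 0 := by
    calc aeval M (X - C z) = aeval M ((a * (X - C z) ^ d + b * h) * (X - C z)) := by
          rw [hab, one_mul]
      _ = 0 := by
          rw [add_mul, mul_assoc b, map_add, map_mul, map_mul, map_mul, hMz, hh0]
          simp
  refine ⟨z, ?_⟩
  rw [map_sub, aeval_X, aeval_C, sub_eq_zero] at h1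
  exact h1

theorem Matrix.trace_pi_mulLeft {n : ℕ} {d : Fin n → ℕ}
    (x : Π i, Matrix (Fin (d i)) (Fin (d i)) ℂ) :
    LinearMap.trace ℂ _ (LinearMap.mulLeft ℂ x) = ∑ i, (d i : ℂ) * (x i).trace := by
  let b := Pi.basis fun i => Matrix.stdBasis ℂ (Fin (d i)) (Fin (d i))
  rw [LinearMap.trace_eq_matrix_trace ℂ b, Matrix.trace, Fintype.sum_sigma]
  refine Finset.sum_congr rfl fun i _ => ?_
  rw [Fintype.sum_prod_type]
  have : ∀ k l, Matrix.diag (LinearMap.toMatrix b b (LinearMap.mulLeft ℂ x)) ⟨i, k, l⟩ =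
      x i k k := by
    intro k l
    simp only [Matrix.diag_apply, LinearMap.toMatrix_apply, b, Pi.basis_apply, Pi.basis_repr,
      LinearMap.mulLeft_apply, Matrix.stdBasis_eq_single, Pi.mul_apply, Pi.single_eq_same]
    simp [Matrix.stdBasis, Matrix.mul_apply, Matrix.single_apply]
  simp only [this]
  simp [Matrix.trace, Finset.mul_sum]

theorem MonoidAlgebra.trace_mulLeft_single {G : Type*} [Group G] [Fintype G] {g : G} (hg : g ≠ 1) :
    LinearMap.trace ℂ (MonoidAlgebra ℂ G) (LinearMap.mulLeft ℂ (MonoidAlgebra.single g 1)) = 0 := by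
  classical
  let b : Module.Basis G ℂ (MonoidAlgebra ℂ G) := MonoidAlgebra.basis G ℂ
  rw [LinearMap.trace_eq_matrix_trace ℂ b, Matrix.trace]
  refine Finset.sum_eq_zero fun h _ => ?_
  rw [Matrix.diag_apply, LinearMap.toMatrix_apply]
  simp [b, MonoidAlgebra.basis, hg]

theorem MonoidAlgebra.commute_sum_of {G : Type*} [Group G] {C : Finset G}
    (hC : ∀ h, ∀ x ∈ C, h * x * h⁻¹ ∈ C) (a : MonoidAlgebra ℂ G) :
    Commute (∑ x ∈ C, MonoidAlgebra.of ℂ G x) a := by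
  have key : ∀ h : G, Commute (∑ x ∈ C, MonoidAlgebra.of ℂ G x) (MonoidAlgebra.of ℂ G h) := by
    intro h
    rw [Commute, SemiconjBy, Finset.sum_mul, Finset.mul_sum]
    refine (Finset.sum_bij' (fun x _ => h * x * h⁻¹) (fun x _ => h⁻¹ * x * h)
      (fun x hx => hC h x hx) (fun x hx => by simpa using hC h⁻¹ x hx)
      (fun x _ => by group) (fun x _ => by group) fun x _ => ?_).symm
    rw [← map_mul, ← map_mul]
    congr 1
    group
  induction a using MonoidAlgebra.induction_on with
  | of g => exact key g
  | add f g hf hg => exact hf.add_right hg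
  | smul r f hf => exact hf.smul_right r

theorem Matrix.exists_eq_scalar_of_surjective {A : Type*} [Semiring A] {d : ℕ}
    [Algebra ℂ A]
    {f : A →ₐ[ℂ] Matrix (Fin d) (Fin d) ℂ} (hf : Function.Surjective f) {a : A}
    (ha : ∀ b, Commute a b) : ∃ z : ℂ, f a = Matrix.scalar (Fin d) z := by
  obtain ⟨z, hz⟩ := Matrix.mem_range_scalar_of_commute_single (M := f a) fun i j _ => by
    obtain ⟨b, hb⟩ := hf (Matrix.single i j 1)
    rw [← hb]
    exact ((ha b).map f).symm
  exact ⟨z, hz.symm⟩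

section Wedderburn

variable {G : Type*} [Group G] {n : ℕ} {d : Fin n → ℕ}
  (e : MonoidAlgebra ℂ G ≃ₐ[ℂ] Π i, Matrix (Fin (d i)) (Fin (d i)) ℂ)

/-- The irreducible algebra representation given by a factor of a Wedderburn decomposition. -/
noncomputable def wedderburnProj (i : Fin n) :
    MonoidAlgebra ℂ G →ₐ[ℂ] Matrix (Fin (d i)) (Fin (d i)) ℂ :=
  (Pi.evalAlgHom ℂ _ i).comp e.toAlgHom

theorem wedderburnProj_symm (x : Π i, Matrix (Fin (d i)) (Fin (d i)) ℂ) (i : Fin n) :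
    wedderburnProj e i (e.symm x) = x i := by
  simp [wedderburnProj]

theorem wedderburnProj_surjective (i : Fin n) : Function.Surjective (wedderburnProj e i) :=
  fun M => ⟨e.symm (Pi.single i M), by simp [wedderburnProj_symm]⟩

/-- The irreducible group representation given by a factor of a Wedderburn decomposition. -/
noncomputable def wedderburnRep (i : Fin n) : G →* Matrix (Fin (d i)) (Fin (d i)) ℂ :=
  (wedderburnProj e i : MonoidAlgebra ℂ G →* _).comp (MonoidAlgebra.of ℂ G)

theorem wedderburnRep_apply (i : Fin n) (g : G) :
    wedderburnRep e i g = wedderburnProj e i (MonoidAlgebra.of ℂ G g) := rfl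

theorem sum_mul_trace_wedderburnRep [Fintype G] {g : G} (hg : g ≠ 1) :
    ∑ i, (d i : ℂ) * (wedderburnRep e i g).trace = 0 := by
  rw [← MonoidAlgebra.trace_mulLeft_single hg, ← LinearMap.trace_conj' _ e.toLinearEquiv]
  have : e.toLinearEquiv.conj (LinearMap.mulLeft ℂ (MonoidAlgebra.single g 1)) =
      LinearMap.mulLeft ℂ (e (MonoidAlgebra.single g 1)) := by
    refine LinearMap.ext fun x => ?_
    simp [LinearEquiv.conj_apply]
  rw [this, Matrix.trace_pi_mulLeft]
  rfl

theorem wedderburnProj_eq_scalar {i : Fin n} (hi : ∀ g, wedderburnRep e i g = 1)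
    (a : MonoidAlgebra ℂ G) : wedderburnProj e i a =
      algebraMap ℂ _ (MonoidAlgebra.lift ℂ ℂ G (1 : G →* ℂ) a) := by
  have : wedderburnProj e i = (Algebra.ofId ℂ (Matrix (Fin (d i)) (Fin (d i)) ℂ)).comp
      (MonoidAlgebra.lift ℂ ℂ G (1 : G →* ℂ)) := by
    refine MonoidAlgebra.algHom_ext (fun g => ?_) (by ext)
    refine (hi g).trans ?_
    simp
  rw [this]
  rfl

theorem wedderburnRep_trivial_unique [∀ i, NeZero (d i)] {i j : Fin n} (hi : ∀ g, wedderburnRep e i g = 1)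
    (hj : ∀ g, wedderburnRep e j g = 1) : i = j := by
  by_contra hij
  have h1 := wedderburnProj_eq_scalar e hi (e.symm (Pi.single i 1))
  have h2 := wedderburnProj_eq_scalar e hj (e.symm (Pi.single i 1))
  rw [wedderburnProj_symm, Pi.single_eq_same, ← map_one (algebraMap ℂ _)] at h1
  rw [wedderburnProj_symm, Pi.single_eq_of_ne (Ne.symm hij), ← map_zero (algebraMap ℂ _)] at h2
  have h3 := FaithfulSMul.algebraMap_injective ℂ _ h1
  have h4 := FaithfulSMul.algebraMap_injective ℂ _ h2
  exact one_ne_zero (h3.trans h4.symm)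

theorem wedderburnRep_trivial_degree [∀ i, NeZero (d i)] {i : Fin n} (hi : ∀ g, wedderburnRep e i g = 1) :
    d i = 1 := by
  by_contra hd
  have hd0 := NeZero.ne (d i)
  let k : Fin (d i) := ⟨0, by omega⟩
  let l : Fin (d i) := ⟨1, by omega⟩
  have hkl : k ≠ l := by simp [k, l]
  have h := wedderburnProj_eq_scalar e hi (e.symm (Pi.single i (Matrix.single k k 1)))
  rw [wedderburnProj_symm, Pi.single_eq_same] at h
  have h1 := congrFun (congrFun h k) k
  have h2 := congrFun (congrFun h l) l
  rw [Matrix.algebraMap_matrix_apply, if_pos rfl] at h1 h2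
  rw [← h2] at h1
  simp [hkl] at h1

theorem exists_wedderburnRep_trivial [Fintype G] : ∃ i, ∀ g, wedderburnRep e i g = 1 := by
  let N : MonoidAlgebra ℂ G := ∑ x, MonoidAlgebra.of ℂ G x
  have hN : N ≠ 0 := by
    intro h
    have := congrArg (MonoidAlgebra.lift ℂ ℂ G (1 : G →* ℂ)) h
    simp [N] at this
  have hNe : e N ≠ 0 := by simpa using hN
  obtain ⟨i, hi⟩ := Function.ne_iff.1 hNe
  refine ⟨i, fun g => ?_⟩
  obtain ⟨z, hz⟩ := Matrix.exists_eq_scalar_of_surjective (wedderburnProj_surjective e i) (a := N)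
    fun b => MonoidAlgebra.commute_sum_of (fun _ _ _ => Finset.mem_univ _) b
  have hz0 : z ≠ 0 := by
    rintro rfl
    rw [map_zero] at hz
    exact hi hz
  have hgN : MonoidAlgebra.of ℂ G g * N = N := by
    simp only [N, Finset.mul_sum, ← map_mul]
    exact Fintype.sum_equiv (Equiv.mulLeft g) _ _ fun x => rfl
  have h := congrArg (wedderburnProj e i) hgN
  rw [map_mul, ← wedderburnRep_apply] at h
  change wedderburnProj e i N = _ at hz
  rw [hz] at h
  have h2 : z • wedderburnRep e i g = z • 1 := by
    rw [Matrix.smul_one_eq_diagonal]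
    simpa [Matrix.scalar_apply, ← Matrix.smul_one_eq_diagonal] using h
  exact smul_right_injective _ hz0 h2

theorem isIntegral_card_mul_trace_div [Fintype G] [∀ i, NeZero (d i)] (i : Fin n) (g : G) :
    IsIntegral ℤ ((conjugatesOf g).ncard * (wedderburnRep e i g).trace / d i) := by
  classical
  let C : Finset G := (conjugatesOf g).toFinset
  have hC : ∀ h, ∀ x ∈ C, h * x * h⁻¹ ∈ C := by
    intro h x hx
    rw [Set.mem_toFinset, conjugatesOf, Set.mem_ofPred_eq] at hx ⊢
    exact hx.trans (isConj_iff.2 ⟨h, rfl⟩)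
  obtain ⟨ω, hω⟩ := Matrix.exists_eq_scalar_of_surjective (wedderburnProj_surjective e i)
    (a := ∑ x ∈ C, MonoidAlgebra.of ℂ G x) fun b => MonoidAlgebra.commute_sum_of hC b
  replace hω : ∑ x ∈ C, wedderburnRep e i x = algebraMap ℂ _ ω := by
    rw [map_sum] at hω
    exact hω
  have hint : IsIntegral ℤ (∑ x ∈ C, wedderburnRep e i x) := by
    have h := (IsIntegral.of_finite ℤ (∑ x ∈ C, MonoidAlgebra.of ℤ G x)).map
      (MonoidAlgebra.lift ℤ (Matrix (Fin (d i)) (Fin (d i)) ℂ) G (wedderburnRep e i))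
    simpa using h
  have hωint : IsIntegral ℤ ω := by
    rw [hω] at hint
    exact (isIntegral_algebraMap_iff (FaithfulSMul.algebraMap_injective ℂ _)).1 hint
  have htr : ((conjugatesOf g).ncard : ℂ) * (wedderburnRep e i g).trace = d i * ω := by
    have h := congrArg Matrix.trace hω
    rw [Matrix.trace_sum, Finset.sum_congr rfl (g := fun _ => (wedderburnRep e i g).trace),
      Finset.sum_const, ← Set.ncard_eq_toFinset_card'] at h
    · rw [nsmul_eq_mul] at h
      rw [h]
      simp [Matrix.algebraMap_eq_diagonal, Matrix.trace]
    · intro x hx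
      rw [Set.mem_toFinset, conjugatesOf, Set.mem_ofPred_eq, isConj_iff] at hx
      obtain ⟨h, rfl⟩ := hx
      rw [map_mul, Matrix.trace_mul_comm, ← map_mul]
      congr 2
      group
  rw [htr, mul_div_cancel_left₀ _ (by exact_mod_cast NeZero.ne (d i))]
  exact hωint

theorem wedderburnRep_eq_scalar_of_coprime [Fintype G] [∀ i, NeZero (d i)] {i : Fin n} {g : G}
    (hco : Nat.Coprime (d i) (conjugatesOf g).ncard) (htr : (wedderburnRep e i g).trace ≠ 0) :
    ∃ z : ℂ, wedderburnRep e i g = Matrix.scalar (Fin (d i)) z := by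
  have hpow : wedderburnRep e i g ^ Fintype.card G = 1 := by rw [← map_pow, pow_card_eq_one, map_one]
  refine Matrix.eq_scalar_of_isIntegral_trace_div Fintype.card_ne_zero hpow htr ?_
  obtain ⟨u, v, huv⟩ := Nat.isCoprime_iff_coprime.2 hco
  have hd : (d i : ℂ) ≠ 0 := by exact_mod_cast NeZero.ne (d i)
  have huv' : (u : ℂ) * d i + v * (conjugatesOf g).ncard = 1 := by exact_mod_cast huv
  have h : (wedderburnRep e i g).trace / d i = u * (wedderburnRep e i g).trace +
      v * ((conjugatesOf g).ncard * (wedderburnRep e i g).trace / d i) := by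
    field_simp
    linear_combination -huv'
  rw [h]
  have hu : ∀ m : ℤ, IsIntegral ℤ (m : ℂ) := fun m => isIntegral_algebraMap (x := m)
  exact ((hu u).mul (Matrix.isIntegral_trace_of_pow_eq_one Fintype.card_ne_zero hpow)).add
    ((hu v).mul (isIntegral_card_mul_trace_div e i g))

end Wedderburn

theorem exists_rep_scalar_of_conjugatesOf_prime_pow {G : Type*} [Group G] [Finite G] {g : G}
    (hg : g ≠ 1) {p c : ℕ} (hp : p.Prime) (hc : (conjugatesOf g).ncard = p ^ c) :
    ∃ (d : ℕ) (ρ : G →* Matrix (Fin d) (Fin d) ℂ), (∃ h, ρ h ≠ 1) ∧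
      ∃ z : ℂ, ρ g = Matrix.scalar (Fin d) z := by
  have := Fintype.ofFinite G
  have : NeZero (Nat.card G : ℂ) := ⟨by exact_mod_cast Nat.card_pos.ne'⟩
  obtain ⟨n, d, hd, ⟨e⟩⟩ :=
    IsSemisimpleRing.exists_algEquiv_pi_matrix_of_isAlgClosed ℂ (MonoidAlgebra ℂ G)
  by_contra! hcon
  obtain ⟨i₀, hi₀⟩ := exists_wedderburnRep_trivial e
  have hother : ∀ i ∈ Finset.univ.erase i₀, ∃ β : ℂ, IsIntegral ℤ β ∧
      (d i : ℂ) * (wedderburnRep e i g).trace = p * β := by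
    intro i hi
    by_cases htr : (wedderburnRep e i g).trace = 0
    · exact ⟨0, isIntegral_zero, by rw [htr, mul_zero, mul_zero]⟩
    have hnt : ∃ h, wedderburnRep e i h ≠ 1 := by
      by_contra! h
      exact Finset.ne_of_mem_erase hi (wedderburnRep_trivial_unique e h hi₀)
    have hpd : p ∣ d i := by
      by_contra hpd
      obtain ⟨z, hz⟩ := wedderburnRep_eq_scalar_of_coprime e (i := i) (g := g)
        (by rw [hc]; exact ((hp.coprime_iff_not_dvd.2 hpd).pow_left c).symm) htr
      exact hcon (d i) (wedderburnRep e i) hnt z hz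
    obtain ⟨m, hm⟩ := hpd
    refine ⟨m * (wedderburnRep e i g).trace, ?_, ?_⟩
    swap
    · have hm' : (d i : ℂ) = p * m := by exact_mod_cast hm
      rw [hm', mul_assoc]
    exact (isIntegral_algebraMap (R := ℤ) (x := m)).mul
      (Matrix.isIntegral_trace_of_pow_eq_one (n := Fintype.card G) Fintype.card_ne_zero
        (by rw [← map_pow, pow_card_eq_one, map_one]))
  choose! β hβ hβ' using hother
  have hsum := sum_mul_trace_wedderburnRep e hg
  rw [← Finset.add_sum_erase _ _ (Finset.mem_univ i₀), Finset.sum_congr rfl hβ', hi₀,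
    ← Finset.mul_sum, Matrix.trace_one, Fintype.card_fin, wedderburnRep_trivial_degree e hi₀] at hsum
  have hp0 : (p : ℂ) ≠ 0 := by exact_mod_cast hp.ne_zero
  have hγ : IsIntegral ℤ (algebraMap ℚ ℂ (-1 / p)) := by
    have h : algebraMap ℚ ℂ (-1 / p) = ∑ i ∈ Finset.univ.erase i₀, β i := by
      simp only [map_div₀, map_neg, map_one, map_natCast]
      rw [div_eq_iff hp0]
      push_cast at hsum
      linear_combination -hsum
    rw [h]
    exact IsIntegral.sum _ hβ
  rw [isIntegral_algebraMap_iff (algebraMap ℚ ℂ).injective] at hγ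
  obtain ⟨m, hm⟩ := IsIntegrallyClosed.isIntegral_iff.1 hγ
  have hp0' : (p : ℚ) ≠ 0 := by exact_mod_cast hp.ne_zero
  rw [eq_div_iff hp0'] at hm
  rw [eq_intCast] at hm
  have hm' : m * (p : ℤ) = -1 := by exact_mod_cast hm
  have : (p : ℤ) ∣ 1 := ⟨-m, by linarith⟩
  exact hp.one_lt.ne' (by exact_mod_cast Int.eq_one_of_dvd_one (by positivity) this)

theorem isSolvable_of_conjugatesOf_prime_pow {G : Type*} [Group G] [Finite G] [IsSimpleGroup G]
    {g : G} (hg : g ≠ 1) {p c : ℕ} (hp : p.Prime) (hc : (conjugatesOf g).ncard = p ^ c) :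
    Group.IsSolvable G := by
  obtain ⟨d, ρ, ⟨h, hh⟩, z, hz⟩ := exists_rep_scalar_of_conjugatesOf_prime_pow hg hp hc
  have hker : ρ.ker = ⊥ := by
    refine (IsSimpleGroup.eq_bot_or_eq_top_of_normal ρ.ker inferInstance).resolve_right fun ht => ?_
    exact hh (by rw [← MonoidHom.mem_ker, ht]; trivial)
  have hinj := (MonoidHom.ker_eq_bot_iff ρ).1 hker
  have hcen : g ∈ Subgroup.center G := by
    rw [Subgroup.mem_center_iff]
    intro x
    apply hinj
    rw [map_mul, map_mul, hz]
    exact (Matrix.scalar_commute z (fun _ => Commute.all _ _) _).symm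
  have htop := (IsSimpleGroup.eq_bot_or_eq_top_of_normal (Subgroup.center G) inferInstance).resolve_left
    fun hb => hg (by rwa [hb, Subgroup.mem_bot] at hcen)
  refine Group.isSolvable_of_comm fun a b => ?_
  have ha : b ∈ Subgroup.center G := by rw [htop]; trivial
  exact Subgroup.mem_center_iff.1 ha a

theorem ncard_conjugatesOf {G : Type*} [Group G] (g : G) :
    (conjugatesOf g).ncard = (Subgroup.centralizer {g}).index := by
  have h1 : conjugatesOf g = MulAction.orbit (ConjAct G) g := by
    ext x
    rw [ConjAct.mem_orbit_conjAct, isConj_comm]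
    rfl
  rw [h1, ← MulAction.index_stabilizer, ConjAct.stabilizer_eq_centralizer]
  rfl

/-- **Burnside's theorem**: finite groups whose order has at most two prime factors are
solvable. -/
theorem isSolvable_of_card_eq_prime_pow_mul_prime_pow {p q : ℕ} (hp : p.Prime) (hq : q.Prime)
    (G : Type*) [Group G] [Finite G] (hG : ∃ a b, Nat.card G = p ^ a * q ^ b) :
    Group.IsSolvable G := by
  induction hn : Nat.card G using Nat.strong_induction_on generalizing G with
  | _ n ih =>
  have hdiv : ∀ m, m ∣ Nat.card G → ∃ a b, m = p ^ a * q ^ b := by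
    intro m hm
    obtain ⟨a, b, hab⟩ := hG
    rw [hab] at hm
    obtain ⟨x, y, hx, hy, rfl⟩ := exists_dvd_and_dvd_of_dvd_mul hm
    obtain ⟨i, -, rfl⟩ := (Nat.dvd_prime_pow hp).1 hx
    obtain ⟨j, -, rfl⟩ := (Nat.dvd_prime_pow hq).1 hy
    exact ⟨i, j, rfl⟩
  by_cases hsimple : ∃ N : Subgroup G, N.Normal ∧ N ≠ ⊥ ∧ N ≠ ⊤
  · obtain ⟨N, hN, hbot, htop⟩ := hsimple
    have hmul := N.card_mul_index
    have h1 : 1 < Nat.card N := N.one_lt_card_iff_ne_bot.2 hbot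
    have h2 : 1 < N.index := by
      have := N.index_ne_zero_of_finite
      have := mt N.index_eq_one.1 htop
      omega
    have hN' : Group.IsSolvable N := ih (Nat.card N) (by rw [← hn]; nlinarith) N
      (hdiv _ N.card_subgroup_dvd_card) rfl
    have hQ : Group.IsSolvable (G ⧸ N) := ih (Nat.card (G ⧸ N))
      (by rw [← hn, ← Subgroup.index]; nlinarith) (G ⧸ N)
      (hdiv _ N.card_quotient_dvd_card) rfl
    exact (Group.isSolvable_iff_subgroup_quotient N).2 ⟨hN', hQ⟩
  rcases subsingleton_or_nontrivial G with hs | hnt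
  · infer_instance
  have : IsSimpleGroup G := ⟨fun N hN => by
    by_contra! h
    exact hsimple ⟨N, hN, h⟩⟩
  obtain ⟨a, b, hab⟩ := hG
  have : Fact p.Prime := ⟨hp⟩
  have : Fact q.Prime := ⟨hq⟩
  by_cases hpdvd : p ∣ Nat.card G
  · obtain ⟨P⟩ : Nonempty (Sylow p G) := inferInstance
    have hP : Nontrivial P := (Subgroup.nontrivial_iff_ne_bot _).2 (P.ne_bot_of_dvd_card hpdvd)
    have hc := P.isPGroup'.center_nontrivial
    obtain ⟨⟨⟨z, hzP⟩, hzc⟩, hz1⟩ := exists_ne (1 : Subgroup.center P)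
    have hz : z ≠ 1 := fun h => hz1 (by ext; exact h)
    have hle : (P : Subgroup G) ≤ Subgroup.centralizer {z} := by
      intro x hx
      rw [Subgroup.mem_centralizer_singleton_iff]
      exact congrArg Subtype.val (Subgroup.mem_center_iff.1 hzc ⟨x, hx⟩)
    have hidx : (Subgroup.centralizer {z}).index ∣ q ^ b := by
      have h1 := Subgroup.index_dvd_of_le hle
      have h2 : Nat.Coprime (P : Subgroup G).index (p ^ a) :=
        ((hp.coprime_iff_not_dvd.2 P.not_dvd_index).pow_left a).symm
      have h3 : (P : Subgroup G).index ∣ p ^ a * q ^ b := by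
        rw [← hab]; exact Subgroup.index_dvd_card _
      exact h1.trans (h2.dvd_of_dvd_mul_left h3)
    obtain ⟨c, -, hc'⟩ := (Nat.dvd_prime_pow hq).1 hidx
    exact isSolvable_of_conjugatesOf_prime_pow hz hq ((ncard_conjugatesOf z).trans hc')
  · have ha : a = 0 := by
      by_contra ha
      exact hpdvd (by rw [hab]; exact (dvd_pow_self p ha).mul_right _)
    have hpg : IsPGroup q G := IsPGroup.of_card (n := b) (by rw [hab, ha]; simp)
    have := hpg.isNilpotent
    infer_instance

/-- A nontrivial finite solvable group has a nontrivial abelian normal subgroup. -/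
theorem exists_normal_abelian_ne_bot (G : Type*) [Group G] [Nontrivial G] [Group.IsSolvable G] :
    ∃ N : Subgroup G, N.Normal ∧ N ≠ ⊥ ∧ ∀ x ∈ N, ∀ y ∈ N, x * y = y * x := by
  classical
  have hex : ∃ n, derivedSeries G n = ⊥ := Group.IsSolvable.solvable
  have hk := Nat.find_spec hex
  obtain ⟨m, hm⟩ : ∃ m, Nat.find hex = m + 1 := by
    refine Nat.exists_eq_succ_of_ne_zero fun h0 => ?_
    rw [h0, derivedSeries_zero] at hk
    exact top_ne_bot hk
  rw [hm, derivedSeries_succ, Subgroup.commutator_eq_bot_iff_le_centralizer] at hk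
  refine ⟨derivedSeries G m, inferInstance, Nat.find_min hex (by omega), fun x hx y hy => ?_⟩
  exact (Subgroup.mem_centralizer_iff.1 (hk hx) y hy).symm

/-- The hypotheses of being an asymmetric, connected, arc-transitive digraph with at least one arc
in which all vertices have out-valence `4`. -/
structure IsAsymmArcTransitiveFour {V : Type*} (A : V → V → Prop) : Prop where
  asymm : ∀ u v : V, A u v → ¬ A v u
  connected : ∀ u v : V, Relation.ReflTransGen (fun a b => A a b ∨ A b a) u v
  exists_arc : ∃ u v : V, A u v
  arcTransitive : ∀ u v u' v' : V, A u v → A u' v' →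
    ∃ g : Equiv.Perm V, (∀ x y : V, A (g x) (g y) ↔ A x y) ∧ g u = u' ∧ g v = v'
  ncard_out : ∀ v : V, {w : V | A v w}.ncard = 4

/-- The automorphism group of a relation. -/
def relAut {V : Type*} (A : V → V → Prop) : Subgroup (Equiv.Perm V) where
  carrier := {g | ∀ x y, A (g x) (g y) ↔ A x y}
  one_mem' _ _ := Iff.rfl
  mul_mem' hg hh x y := (hg _ _).trans (hh x y)
  inv_mem' {g} hg x y := by rw [← hg]; simp

/-- The existence of a non-identity semiregular automorphism. -/
def HasSemiregularAut {V : Type*} (A : V → V → Prop) : Prop :=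
  ∃ g ∈ relAut A, g ≠ 1 ∧ IsSemiregularElt V g

theorem isSemiregularElt_of_prime {V : Type*} {g : Equiv.Perm V} {p : ℕ} (hp : p.Prime)
    (hg : g ^ p = 1) (hfix : ∀ x, g x ≠ x) : IsSemiregularElt V g := by
  rintro n ⟨x, hx⟩
  by_cases hpn : (p : ℤ) ∣ n
  · obtain ⟨m, rfl⟩ := hpn
    rw [zpow_mul, zpow_natCast, hg, one_zpow]
  · exfalso
    obtain ⟨a, b, hab⟩ := (Nat.prime_iff_prime_int.1 hp).coprime_iff_not_dvd.2 hpn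
    apply hfix x
    have h1 : g = (g ^ n) ^ b := by
      rw [← zpow_mul, mul_comm, ← zpow_one g]
      nth_rw 1 [← hab]
      rw [zpow_add, mul_comm a, zpow_mul, zpow_natCast, hg]
      simp
    rw [h1]
    exact Equiv.Perm.zpow_apply_eq_self_of_apply_eq_self hx b

theorem isSemiregularElt_of_commute {V : Type*} {z : Equiv.Perm V}
    (hz : ∀ u v : V, ∃ g : Equiv.Perm V, Commute g z ∧ g u = v) : IsSemiregularElt V z := by
  rintro n ⟨x, hx⟩
  ext y
  obtain ⟨g, hg, rfl⟩ := hz x y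
  rw [← Equiv.Perm.mul_apply, ← (hg.zpow_right n).eq, Equiv.Perm.mul_apply]
  exact congrArg g hx

namespace IsAsymmArcTransitiveFour

variable {V : Type*} {A : V → V → Prop}

theorem exists_out (h : IsAsymmArcTransitiveFour A) (v : V) : ∃ w, A v w := by
  have : {w : V | A v w}.Nonempty := by
    apply Set.nonempty_of_ncard_ne_zero
    rw [h.ncard_out]
    norm_num
  exact this

theorem vertexTransitive (h : IsAsymmArcTransitiveFour A) (u v : V) : ∃ g ∈ relAut A, g u = v := by
  obtain ⟨u', hu⟩ := h.exists_out u
  obtain ⟨v', hv⟩ := h.exists_out v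
  obtain ⟨g, hg, h1, -⟩ := h.arcTransitive u u' v v' hu hv
  exact ⟨g, hg, h1⟩

theorem stronglyConnected [Finite V] (h : IsAsymmArcTransitiveFour A) (u v : V) :
    Relation.ReflTransGen A u v := by
  have hle : ∀ u v, {w | Relation.ReflTransGen A u w}.ncard ≤
      {w | Relation.ReflTransGen A v w}.ncard := by
    intro u v
    obtain ⟨g, hg, rfl⟩ := h.vertexTransitive u v
    rw [← Set.ncard_image_of_injective _ g.injective]
    refine Set.ncard_le_ncard ?_
    rintro _ ⟨w, hw, rfl⟩
    exact Relation.ReflTransGen.lift g (fun x y => (hg x y).2) _ _ hw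
  have hsymm : ∀ a b, A a b → Relation.ReflTransGen A b a := by
    intro a b hab
    have := Set.eq_of_subset_of_ncard_le (s := {w | Relation.ReflTransGen A b w})
      (t := {w | Relation.ReflTransGen A a w}) (fun w hw => Relation.ReflTransGen.head hab hw)
      (hle a b)
    have ha : a ∈ {w | Relation.ReflTransGen A a w} := Relation.ReflTransGen.refl
    rwa [← this] at ha
  induction h.connected u v with
  | refl => exact Relation.ReflTransGen.refl
  | tail _ hbc ih =>
    rcases hbc with hbc | hbc
    · exact ih.tail hbc
    · exact ih.trans (hsymm _ _ hbc)

theorem forall_of_closed [Finite V] (h : IsAsymmArcTransitiveFour A) {P : V → Prop}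
    (hP : ∀ u v, A u v → P u → P v) {u : V} (hu : P u) (v : V) : P v := by
  induction h.stronglyConnected u v with
  | refl => exact hu
  | tail _ hbc ih => exact hP _ _ hbc ih

theorem ncard_in [Finite V] (h : IsAsymmArcTransitiveFour A) (v : V) :
    {u : V | A u v}.ncard = 4 := by
  classical
  have := Fintype.ofFinite V
  have hconst : ∀ w, {u : V | A u w}.ncard = {u : V | A u v}.ncard := by
    intro w
    obtain ⟨g, hg, rfl⟩ := h.vertexTransitive v w
    rw [← Set.ncard_image_of_injective {u : V | A u v} g.injective]
    congr 1
    ext x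
    constructor
    · intro hx
      refine ⟨g⁻¹ x, ?_, by simp⟩
      have : A (g (g⁻¹ x)) (g v) := by simpa using hx
      exact (hg _ _).1 this
    · rintro ⟨y, hy, rfl⟩
      exact (hg _ _).2 hy
  have hcount := Finset.sum_card_bipartiteAbove_eq_sum_card_bipartiteBelow (s := Finset.univ)
    (t := Finset.univ) A
  have hout : ∀ a, (Finset.bipartiteAbove A Finset.univ a).card = 4 := by
    intro a
    rw [← h.ncard_out a, ← Set.ncard_coe_finset]
    congr 1
    ext
    simp [Finset.bipartiteAbove]
  have hin : ∀ a, (Finset.bipartiteBelow A Finset.univ a).card = {u : V | A u v}.ncard := by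
    intro a
    rw [← hconst a, ← Set.ncard_coe_finset]
    congr 1
    ext
    simp [Finset.bipartiteBelow]
  simp only [hout, hin, Finset.sum_const, smul_eq_mul] at hcount
  have : 0 < (Finset.univ : Finset V).card := Finset.card_pos.2 ⟨v, Finset.mem_univ v⟩
  exact (Nat.eq_of_mul_eq_mul_left this hcount).symm

theorem exists_fixed_moved_out [Finite V] (h : IsAsymmArcTransitiveFour A) {g : Equiv.Perm V}
    (hg : g ≠ 1) {v : V} (hv : g v = v) : ∃ u w, g u = u ∧ A u w ∧ g w ≠ w := by
  by_contra! hcon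
  exact hg (Equiv.ext fun w =>
    h.forall_of_closed (P := fun x => g x = x) (fun a b hab ha => hcon a b ha hab) hv w)

theorem prime_eq_two_or_three [Finite V] (h : IsAsymmArcTransitiveFour A) {g : Equiv.Perm V}
    (hg : g ∈ relAut A) (hg1 : g ≠ 1) {p : ℕ} (hp : p.Prime) (hgp : g ^ p = 1) {v : V}
    (hv : g v = v) : p = 2 ∨ p = 3 := by
  obtain ⟨u, w, hu, huw, hw⟩ := h.exists_fixed_moved_out hg1 hv
  have hmem : ∀ x, A u (g x) ↔ A u x := fun x => by
    conv_lhs => rw [← hu]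
    exact hg u x
  let σ : Equiv.Perm {x // A u x} := g.subtypePerm hmem
  have hσ : σ ^ p = 1 := by
    rw [Equiv.Perm.subtypePerm_pow]
    ext x
    simp [hgp]
  have hσ1 : σ ≠ 1 := by
    intro hσ1
    exact hw (congrArg Subtype.val (DFunLike.congr_fun hσ1 (⟨w, huw⟩ : {x // A u x})))
  have : Fact p.Prime := ⟨hp⟩
  have hord : orderOf σ = p := orderOf_eq_prime hσ hσ1
  have hdvd : p ∣ 24 := by
    rw [← hord]
    refine (orderOf_dvd_natCard σ).trans ?_
    rw [Nat.card_perm, show Nat.card {x // A u x} = 4 from h.ncard_out u]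
    rfl
  have h24 : (24 : ℕ) = 2 ^ 3 * 3 := by norm_num
  rw [h24, hp.dvd_mul] at hdvd
  rcases hdvd with hd | hd
  · exact Or.inl ((Nat.prime_dvd_prime_iff_eq hp Nat.prime_two).1 (hp.dvd_of_dvd_pow hd))
  · exact Or.inr ((Nat.prime_dvd_prime_iff_eq hp Nat.prime_three).1 hd)

end IsAsymmArcTransitiveFour

theorem apply_inv_apply {V : Type*} (g : Equiv.Perm V) (x : V) : g (g⁻¹ x) = x :=
  g.apply_symm_apply x

section Twins

variable {V : Type*} {A : V → V → Prop}

/-- If two distinct vertices of a vertex-transitive digraph have the same neighbourhoods, then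
cyclically permuting the classes of such vertices is semiregular. -/
theorem hasSemiregularAut_of_twins [Finite V] (ht : ∀ u v, ∃ g ∈ relAut A, g u = v) {a b : V}
    (hab : a ≠ b) (htwin : ∀ x, (A a x ↔ A b x) ∧ (A x a ↔ A x b)) : HasSemiregularAut A := by
  classical
  let r : Setoid V :=
    { r := fun u v => ∀ x, (A u x ↔ A v x) ∧ (A x u ↔ A x v)
      iseqv := ⟨fun _ _ => ⟨Iff.rfl, Iff.rfl⟩, fun h x => ⟨(h x).1.symm, (h x).2.symm⟩,
        fun h k x => ⟨(h x).1.trans (k x).1, (h x).2.trans (k x).2⟩⟩ }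
  let π : V → Quotient r := Quotient.mk r
  have hπ : ∀ {u v}, π u = π v ↔ ∀ x, (A u x ↔ A v x) ∧ (A x u ↔ A x v) := Quotient.eq
  have hle : ∀ u v, Nat.card {x // π x = π u} ≤ Nat.card {x // π x = π v} := by
    intro u v
    obtain ⟨g, hg, rfl⟩ := ht u v
    refine Nat.card_le_card_of_injective (fun x => ⟨g x.1, ?_⟩) ?_
    · rw [hπ]
      intro y
      have := hπ.1 x.2 (g⁻¹ y)
      rw [← hg, ← hg u, ← hg _ x.1, ← hg _ u] at this
      simpa using this
    · intro x y hxy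
      exact Subtype.ext (g.injective (congrArg Subtype.val hxy))
  set m := Nat.card {x // π x = π a} with hm
  have hm0 : NeZero m := ⟨by
    have : Nonempty {x // π x = π a} := ⟨⟨a, rfl⟩⟩
    exact Nat.card_pos.ne'⟩
  have hm1 : 1 < m := by
    have : Nontrivial {x // π x = π a} :=
      ⟨⟨a, rfl⟩, ⟨b, (hπ.2 htwin).symm⟩, fun h => hab (congrArg Subtype.val h)⟩
    exact Finite.one_lt_card
  have hfib : ∀ q : Quotient r, Nonempty ({x // π x = q} ≃ ZMod m) := by
    intro q
    obtain ⟨u, rfl⟩ := Quotient.exists_rep q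
    refine Finite.card_eq.1 ?_
    rw [Nat.card_zmod]
    exact le_antisymm (hle u a) (hle a u)
  let φ : V ≃ Quotient r × ZMod m := (Equiv.sigmaFiberEquiv π).symm.trans
    ((Equiv.sigmaCongrRight fun q => (hfib q).some).trans (Equiv.sigmaEquivProd _ _))
  have hφ : ∀ x, (φ x).1 = π x := fun x => rfl
  let g : Equiv.Perm V :=
    φ.trans (((Equiv.refl _).prodCongr (Equiv.addRight 1)).trans φ.symm)
  have hg : ∀ x, φ (g x) = ((φ x).1, (φ x).2 + 1) := fun x =>
    φ.apply_symm_apply _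
  have hginv : ∀ x, φ (g⁻¹ x) = ((φ x).1, (φ x).2 - 1) := fun x => by
    have := hg (g⁻¹ x)
    rw [apply_inv_apply] at this
    rw [this]
    simp
  have hgn : ∀ (n : ℤ) x, φ ((g ^ n) x) = ((φ x).1, (φ x).2 + n) := by
    intro n
    induction n using Int.induction_on with
    | zero => simp
    | succ k ih =>
      intro x
      rw [zpow_add_one, Equiv.Perm.mul_apply, ih, hg]
      push_cast
      ring_nf
    | pred k ih =>
      intro x
      rw [zpow_sub_one, Equiv.Perm.mul_apply, ih, hginv]
      push_cast
      ring_nf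
  have hgπ : ∀ x, π (g x) = π x := fun x => by rw [← hφ, hg, hφ]
  refine ⟨g, fun x y => ?_, fun h1 => ?_, ?_⟩
  · exact ((hπ.1 (hgπ x) _).1).trans ((hπ.1 (hgπ y) _).2)
  · have := hg a
    rw [h1] at this
    have h2 := congrArg Prod.snd this
    have : Fact (1 < m) := ⟨hm1⟩
    simp at h2
  · rintro n ⟨x, hx⟩
    have h1 := hgn n x
    rw [show (g ^ n) x = x from hx] at h1
    have h2 : (n : ZMod m) = 0 := by simpa using congrArg Prod.snd h1
    ext y
    apply φ.injective
    rw [hgn, h2, add_zero]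
    rfl

end Twins

theorem semiconj_zpow_apply {V W : Type*} {g : Equiv.Perm V} {k : Equiv.Perm W} {f : V → W}
    (h : ∀ x, f (g x) = k (f x)) (n : ℤ) (x : V) : f ((g ^ n) x) = (k ^ n) (f x) := by
  have hinv : ∀ x, f (g⁻¹ x) = k⁻¹ (f x) := fun x => by
    rw [Equiv.Perm.eq_inv_iff_eq, ← h, apply_inv_apply]
  induction n using Int.induction_on generalizing x with
  | zero => rfl
  | succ m ih => rw [zpow_add_one, zpow_add_one, Equiv.Perm.mul_apply, ih, h, Equiv.Perm.mul_apply]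
  | pred m ih =>
    rw [zpow_sub_one, zpow_sub_one, Equiv.Perm.mul_apply, ih, hinv, Equiv.Perm.mul_apply]

universe u

/-- A digraph all of whose arcs lie in complete bipartite pieces is a line digraph, and one can
pass to the digraph of which it is the line digraph. -/
theorem hasSemiregularAut_of_lineDigraph {V : Type u} [Finite V] {A : V → V → Prop}
    (h : IsAsymmArcTransitiveFour A) (hline : ∀ u v w, A u w → A v w → ∀ y, A u y → A v y)
    (ih : ∀ (W : Type u) [Finite W] (B : W → W → Prop), IsAsymmArcTransitiveFour B →
      Nat.card W < Nat.card V → HasSemiregularAut B) : HasSemiregularAut A := by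
  by_cases htwin : ∃ a b, a ≠ b ∧ ∀ x, (A a x ↔ A b x) ∧ (A x a ↔ A x b)
  · obtain ⟨a, b, hab, hx⟩ := htwin
    exact hasSemiregularAut_of_twins h.vertexTransitive hab hx
  have hpre : ∀ v, ∃ u, A u v := fun v => by
    have : {u : V | A u v}.Nonempty := by
      apply Set.nonempty_of_ncard_ne_zero
      rw [h.ncard_in]
      norm_num
    exact this
  choose pre hpre using hpre
  let W := Set.range fun u => {w | A u w}
  let o : V → W := fun u => ⟨{w | A u w}, u, rfl⟩
  have ho : ∀ {u v}, o u = o v ↔ ∀ y, A u y ↔ A v y := fun {u v} => by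
    rw [Subtype.ext_iff, Set.ext_iff]
    rfl
  have ho_surj : Function.Surjective o := by
    rintro ⟨_, u, rfl⟩
    exact ⟨u, rfl⟩
  have hline' : ∀ {u v w}, A u w → A v w → o u = o v := fun hu hv =>
    ho.2 fun y => ⟨hline _ _ _ hu hv y, hline _ _ _ hv hu y⟩
  let t : V → W := fun v => o (pre v)
  have hA : ∀ {u v}, A u v ↔ o u = t v := fun {u v} =>
    ⟨fun huv => hline' huv (hpre v), fun huv => (ho.1 huv v).2 (hpre v)⟩
  have hinj : ∀ {v w}, t v = t w → o v = o w → v = w := by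
    intro v w h1 h2
    by_contra hvw
    exact htwin ⟨v, w, hvw, fun x => ⟨ho.1 h2 x, by rw [hA, hA, h1]⟩⟩
  let B : W → W → Prop := fun X Y => ∃ v, t v = X ∧ o v = Y
  have hoB : ∀ {u v}, A u v → B (o u) (o v) := fun {u v} huv => ⟨v, (hA.1 huv).symm, rfl⟩
  have hB : IsAsymmArcTransitiveFour B := by
    refine ⟨?_, ?_, ?_, ?_, ?_⟩
    · rintro _ _ ⟨v, rfl, rfl⟩ ⟨w, hw1, hw2⟩
      exact h.asymm v w (hA.2 hw1.symm) (hA.2 hw2)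
    · intro X Y
      obtain ⟨u, rfl⟩ := ho_surj X
      obtain ⟨v, rfl⟩ := ho_surj Y
      exact Relation.ReflTransGen.lift o (fun x y hxy => hxy.imp hoB hoB) _ _ (h.connected u v)
    · obtain ⟨u, v, huv⟩ := h.exists_arc
      exact ⟨_, _, hoB huv⟩
    · rintro _ _ _ _ ⟨v, rfl, rfl⟩ ⟨v', rfl, rfl⟩
      obtain ⟨g, hg, hgu, hgv⟩ := h.arcTransitive _ _ _ _ (hpre v) (hpre v')
      have himage : ∀ u, g '' {w | A u w} = {w | A (g u) w} := fun u => by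
        ext w
        constructor
        · rintro ⟨x, hx, rfl⟩
          exact (hg _ _).2 hx
        · intro hw
          refine ⟨g⁻¹ w, ?_, by simp⟩
          have : A (g u) (g (g⁻¹ w)) := by simpa using hw
          exact (hg _ _).1 this
      let k₀ : W → W := fun X => ⟨g '' X.1, by
        obtain ⟨_, u, rfl⟩ := X
        exact ⟨g u, (himage u).symm⟩⟩
      have hk₀ : Function.Injective k₀ := fun X Y hXY =>
        Subtype.ext (Set.image_injective.2 g.injective (congrArg Subtype.val hXY))
      let k : Equiv.Perm W := Equiv.ofBijective k₀ (Finite.injective_iff_bijective.1 hk₀)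
      have hko : ∀ u, k (o u) = o (g u) := fun u => Subtype.ext (himage u)
      have hkt : ∀ u, k (t u) = t (g u) := fun u => by
        rw [← hA.1 ((hg _ _).2 (hpre u)), ← hko]
      refine ⟨k, fun X Y => ⟨?_, ?_⟩, ?_, ?_⟩
      · rintro ⟨w, hw1, hw2⟩
        refine ⟨g⁻¹ w, k.injective ?_, k.injective ?_⟩
        · rw [hkt, apply_inv_apply, hw1]
        · rw [hko, apply_inv_apply, hw2]
      · rintro ⟨w, rfl, rfl⟩
        exact ⟨g w, (hkt w).symm, (hko w).symm⟩
      · rw [hkt, hgv]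
      · rw [hko, hgv]
    · intro X
      obtain ⟨u, rfl⟩ := ho_surj X
      have : {Y | B (o u) Y} = o '' {v | A u v} := by
        ext Y
        constructor
        · rintro ⟨v, hv, rfl⟩
          exact ⟨v, hA.2 hv.symm, rfl⟩
        · rintro ⟨v, hv, rfl⟩
          exact hoB hv
      rw [this, Set.InjOn.ncard_image, h.ncard_out]
      intro v hv w hw hvw
      exact hinj ((hA.1 hv).symm.trans (hA.1 hw)) hvw
  have hcard : Nat.card W < Nat.card V := by
    obtain ⟨u, v, huv⟩ := h.exists_arc
    refine lt_of_le_of_ne (Nat.card_le_card_of_surjective o ho_surj) fun heq => ?_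
    have hoinj : Function.Injective o :=
      ((Nat.bijective_iff_surjective_and_card o).2 ⟨ho_surj, heq.symm⟩).1
    have hsub : {x | A x v} ⊆ {u} := fun x hx => hoinj (hline' hx huv)
    have := Set.ncard_le_ncard hsub
    rw [h.ncard_in, Set.ncard_singleton] at this
    omega
  obtain ⟨k, hk, hk1, hks⟩ := ih W B hB hcard
  have hlift : ∀ v, ∃ w, t w = k (t v) ∧ o w = k (o v) := fun v => (hk _ _).2 ⟨v, rfl, rfl⟩
  choose g₀ hgt hgo using hlift
  have hg₀ : Function.Injective g₀ := fun v w hvw => by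
    refine hinj (k.injective ?_) (k.injective ?_)
    · rw [← hgt, ← hgt, hvw]
    · rw [← hgo, ← hgo, hvw]
  let g : Equiv.Perm V := Equiv.ofBijective g₀ (Finite.injective_iff_bijective.1 hg₀)
  refine ⟨g, fun x y => ?_, fun hg1 => hk1 ?_, ?_⟩
  · rw [hA, hA]
    change o (g₀ x) = t (g₀ y) ↔ _
    rw [hgt, hgo, k.injective.eq_iff]
  · ext1 Y
    obtain ⟨u, rfl⟩ := ho_surj Y
    rw [← hgo]
    exact congrArg o (DFunLike.congr_fun hg1 u)
  · rintro n ⟨x, hx⟩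
    have hkn : k ^ n = 1 := hks n ⟨o x, by
      change (k ^ n) (o x) = o x
      rw [← semiconj_zpow_apply (g := g) hgo]
      exact congrArg o hx⟩
    ext y
    refine hinj ?_ ?_
    · rw [semiconj_zpow_apply (g := g) hgt, hkn]
      rfl
    · rw [semiconj_zpow_apply (g := g) hgo, hkn]
      rfl

theorem conj_apply_apply {V : Type*} (k n : Equiv.Perm V) (x : V) :
    (k * n * k⁻¹) (k x) = k (n x) := by
  simp

theorem inv_apply_eq_self {V : Type*} {g : Equiv.Perm V} {x : V} (h : g x = x) : g⁻¹ x = x := by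
  rw [Equiv.Perm.inv_eq_iff_eq, h]

namespace IsAsymmArcTransitiveFour

variable {V : Type*} {A : V → V → Prop}

/-- An automorphism of order `3` with a fixed point makes the stabiliser of an arc `(v, x)`
transitive on the other out-neighbours of `v`. -/
theorem exists_fix_arc_apply_eq [Finite V] (h : IsAsymmArcTransitiveFour A) {g : Equiv.Perm V}
    (hg : g ∈ relAut A) (hg1 : g ≠ 1) (hg3 : g ^ 3 = 1) {v₀ : V} (hv₀ : g v₀ = v₀) {v x y z : V}
    (hx : A v x) (hy : A v y) (hz : A v z) (hyx : y ≠ x) (hzx : z ≠ x) :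
    ∃ k ∈ relAut A, k v = v ∧ k x = x ∧ k y = z := by
  obtain ⟨u, w, hu, huw, hw⟩ := h.exists_fixed_moved_out hg1 hv₀
  have hmem : ∀ x, A u (g x) ↔ A u x := fun x => by
    conv_lhs => rw [← hu]
    exact hg u x
  have hg3' : ∀ x, g (g (g x)) = x := fun x => DFunLike.congr_fun hg3 x
  have h12 : g (g w) ≠ g w := fun he => hw (g.injective he)
  have h02 : g (g w) ≠ w := fun he => hw (by conv_lhs => rw [← he, hg3'])
  have hcard : ({w, g w, g (g w)} : Set V).ncard = 3 :=
    Set.ncard_eq_three.2 ⟨_, _, _, hw.symm, h02.symm, h12.symm, rfl⟩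
  obtain ⟨y₀, hy₀, hy₀S⟩ : ∃ y₀, A u y₀ ∧ y₀ ∉ ({w, g w, g (g w)} : Set V) :=
    Set.exists_mem_notMem_of_ncard_lt_ncard (t := {x | A u x}) (by
      rw [hcard, h.ncard_out]
      norm_num)
  have hout : insert y₀ ({w, g w, g (g w)} : Set V) = {x | A u x} := by
    refine Set.eq_of_subset_of_ncard_le ?_ ?_
    · rintro _ (rfl | rfl | rfl | rfl)
      · exact hy₀
      · exact huw
      · exact (hmem _).2 huw
      · exact (hmem _).2 ((hmem _).2 huw)
    · rw [Set.ncard_insert_of_notMem hy₀S, hcard, h.ncard_out]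
  have hpow : ∀ x, A u x → x ≠ y₀ → ∃ n : ℕ, (g ^ n) w = x := by
    intro x hx hxy
    have hx' : x ∈ insert y₀ ({w, g w, g (g w)} : Set V) := hout ▸ hx
    rcases hx' with rfl | rfl | rfl | rfl
    · exact absurd rfl hxy
    · exact ⟨0, rfl⟩
    · exact ⟨1, rfl⟩
    · exact ⟨2, rfl⟩
  have hgy₀ : g y₀ = y₀ := by
    have hx' : g y₀ ∈ insert y₀ ({w, g w, g (g w)} : Set V) := hout ▸ (hmem _).2 hy₀
    rcases hx' with he | he | he | he
    · exact he
    · exact absurd (by rw [← he, hg3'] : y₀ = g (g w)) fun he' => hy₀S (by simp [he'])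
    · exact absurd (g.injective he) fun he' => hy₀S (by simp [he'])
    · exact absurd (g.injective he) fun he' => hy₀S (by simp [he'])
  have hfix : ∀ (n : ℕ) {c : V}, g c = c → (g ^ n) c = c := fun n c hc =>
    Equiv.Perm.pow_apply_eq_self_of_apply_eq_self hc n
  obtain ⟨k, hk, hku, hky⟩ := h.arcTransitive u y₀ v x hy₀ hx
  have hback : ∀ y, A v y → y ≠ x → ∃ n : ℕ, k ((g ^ n) w) = y := by
    intro y hy hyx
    obtain ⟨n, hn⟩ := hpow (k⁻¹ y) ((hk _ _).1 (by rwa [hku, apply_inv_apply])) fun he =>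
      hyx (by rw [← hky, ← he, apply_inv_apply])
    exact ⟨n, by rw [hn, apply_inv_apply]⟩
  obtain ⟨i, rfl⟩ := hback y hy hyx
  obtain ⟨j, rfl⟩ := hback z hz hzx
  have hfix' : ∀ {c : V}, g c = c → (k * (g ^ j * (g ^ i)⁻¹) * k⁻¹) (k c) = k c := fun {c} hc => by
    rw [conj_apply_apply, Equiv.Perm.mul_apply, inv_apply_eq_self (hfix i hc), hfix j hc]
  refine ⟨k * (g ^ j * (g ^ i)⁻¹) * k⁻¹, ?_, ?_, ?_, by simp⟩
  · exact mul_mem (mul_mem hk (mul_mem (pow_mem hg j) (inv_mem (pow_mem hg i)))) (inv_mem hk)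
  · rw [← hku, hfix' hu]
  · rw [← hky, hfix' hgy₀]

theorem exists_mem_fix_apply_eq [Finite V] (h : IsAsymmArcTransitiveFour A)
    (hT : ∀ v x y z, A v x → A v y → A v z → y ≠ x → z ≠ x →
      ∃ k ∈ relAut A, k v = v ∧ k x = x ∧ k y = z)
    {N : Subgroup (Equiv.Perm V)} (hNn : ∀ g ∈ relAut A, ∀ n ∈ N, g * n * g⁻¹ ∈ N)
    {n : Equiv.Perm V} (hn : n ∈ N) (hnA : n ∈ relAut A) (hn1 : n ≠ 1) {v₀ : V} (hv₀ : n v₀ = v₀)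
    {v x y : V} (hx : A v x) (hy : A v y) : ∃ m ∈ N, m v = v ∧ m x = y := by
  obtain ⟨u, w, hu, huw, hw⟩ := h.exists_fixed_moved_out hn1 hv₀
  have hnw : A u (n w) := by
    conv => rw [← hu]
    exact (hnA _ _).2 huw
  have hout : ∀ y, A u y → ∃ m ∈ N, m u = u ∧ m w = y := by
    intro y hy
    by_cases hyw : y = w
    · exact ⟨1, one_mem N, rfl, hyw.symm⟩
    · obtain ⟨k, hk, hku, hkw, hky⟩ := hT u w (n w) y huw hnw hy hw hyw
      refine ⟨k * n * k⁻¹, hNn k hk n hn, ?_, ?_⟩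
      · rw [← hku, conj_apply_apply, hu]
      · rw [← hky, ← conj_apply_apply, hkw]
  obtain ⟨g, hg, rfl⟩ := h.vertexTransitive u v
  have hback : ∀ y, A (g u) y → ∃ m ∈ N, m u = u ∧ g (m w) = y := by
    intro y hy
    obtain ⟨m, hm, hmu, hmw⟩ := hout (g⁻¹ y) ((hg _ _).1 (by rwa [apply_inv_apply]))
    exact ⟨m, hm, hmu, by rw [hmw, apply_inv_apply]⟩
  obtain ⟨m, hm, hmu, rfl⟩ := hback x hx
  obtain ⟨m', hm', hmu', rfl⟩ := hback y hy
  refine ⟨g * (m' * m⁻¹) * g⁻¹, hNn g hg _ (mul_mem hm' (inv_mem hm)), ?_, by simp⟩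
  rw [conj_apply_apply, Equiv.Perm.mul_apply, inv_apply_eq_self hmu, hmu']

/-- If an abelian normal subgroup of the automorphism group has vertex stabilisers which are
transitive on out-neighbours, then the digraph is a line digraph. -/
theorem out_eq_of_common_out [Finite V] (h : IsAsymmArcTransitiveFour A)
    {N : Subgroup (Equiv.Perm V)} (hNA : N ≤ relAut A)
    (hNn : ∀ g ∈ relAut A, ∀ n ∈ N, g * n * g⁻¹ ∈ N) (hcomm : ∀ m ∈ N, ∀ n ∈ N, m * n = n * m)
    (htrans : ∀ v x y, A v x → A v y → ∃ m ∈ N, m v = v ∧ m x = y)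
    (u v w : V) (huw : A u w) (hvw : A v w) (y : V) (hy : A u y) : A v y := by
  let S : V → Subgroup (Equiv.Perm V) := fun v => N ⊓ MulAction.stabilizer (Equiv.Perm V) v
  have hS : ∀ {v n}, n ∈ S v ↔ n ∈ N ∧ n v = v := Iff.rfl
  have hle : ∀ u v, Nat.card (S u) ≤ Nat.card (S v) := by
    intro u v
    obtain ⟨g, hg, rfl⟩ := h.vertexTransitive u v
    refine Nat.card_le_card_of_injective
      (fun n => ⟨g * n.1 * g⁻¹, hS.2 ⟨hNn g hg _ (hS.1 n.2).1, by simp [(hS.1 n.2).2]⟩⟩) ?_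
    intro m n hmn
    have := congrArg Subtype.val hmn
    exact Subtype.ext (by simpa using this)
  have hindex : ∀ a b, (S b).relIndex (S a) = (MulAction.orbit (S a) b).ncard := by
    intro a b
    rw [← MulAction.index_stabilizer, Subgroup.relIndex]
    congr 1
    ext n
    exact ⟨fun hn => hn.2, fun hn => ⟨(hS.1 n.2).1, hn⟩⟩
  have hmul : ∀ a b, Nat.card ↥(S b ⊓ S a) * (S b).relIndex (S a) = Nat.card (S a) := by
    intro a b
    rw [← Subgroup.inf_relIndex_right, ← Subgroup.relIndex_bot_left, ← Subgroup.relIndex_bot_left,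
      Subgroup.relIndex_mul_relIndex _ _ _ bot_le inf_le_right]
  have hout : MulAction.orbit (S u) w = {x | A u x} := by
    ext x
    constructor
    · rintro ⟨n, rfl⟩
      have := (hNA (hS.1 n.2).1 u w).2 huw
      rwa [(hS.1 n.2).2] at this
    · intro hx
      obtain ⟨m, hm, hmu, hmw⟩ := htrans u w x huw hx
      exact ⟨⟨m, hS.2 ⟨hm, hmu⟩⟩, hmw⟩
  have h4 : (MulAction.orbit (S w) u).ncard = 4 := by
    rw [← hindex, ← h.ncard_out u, ← hout, ← hindex]
    refine Nat.eq_of_mul_eq_mul_left (Nat.card_pos (α := ↥(S u ⊓ S w))) ?_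
    rw [hmul, inf_comm, hmul]
    exact le_antisymm (hle w u) (hle u w)
  have hin : MulAction.orbit (S w) u = {x | A x w} := by
    refine Set.eq_of_subset_of_ncard_le ?_ (by rw [h4, h.ncard_in])
    rintro _ ⟨n, rfl⟩
    have := (hNA (hS.1 n.2).1 u w).2 huw
    rwa [(hS.1 n.2).2] at this
  have hv : v ∈ MulAction.orbit (S w) u := hin ▸ hvw
  obtain ⟨⟨n, hn⟩, rfl⟩ := hv
  obtain ⟨hnN, hnw⟩ := hS.1 hn
  obtain ⟨m, hm, -, rfl⟩ := htrans u w y huw hy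
  have hfix : n (m w) = m w := by
    rw [← Equiv.Perm.mul_apply, hcomm n hnN m hm, Equiv.Perm.mul_apply, hnw]
  change A (n u) (m w)
  rw [← hfix]
  exact (hNA hnN _ _).2 hy

end IsAsymmArcTransitiveFour

theorem exists_eq_two_pow_mul_three_pow {n : ℕ} (hn : n ≠ 0)
    (h : ∀ p, p.Prime → p ∣ n → p = 2 ∨ p = 3) : ∃ a b, n = 2 ^ a * 3 ^ b := by
  obtain ⟨a, m, hm, rfl⟩ := Nat.exists_eq_pow_mul_and_not_dvd hn 2 (by norm_num)
  obtain ⟨b, l, hl, rfl⟩ := Nat.exists_eq_pow_mul_and_not_dvd (right_ne_zero_of_mul hn) 3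
    (by norm_num)
  have hl1 : l = 1 := by
    by_contra hl1
    obtain ⟨p, hp, hpl⟩ := Nat.exists_prime_and_dvd hl1
    rcases h p hp ((hpl.mul_left _).mul_left _) with rfl | rfl
    · exact hm (hpl.mul_left _)
    · exact hl hpl
  exact ⟨a, b, by rw [hl1, mul_one]⟩

theorem IsAsymmArcTransitiveFour.hasSemiregularAut {V : Type u} [Finite V] {A : V → V → Prop}
    (h : IsAsymmArcTransitiveFour A) : HasSemiregularAut A := by
  induction hk : Nat.card V using Nat.strong_induction_on generalizing V with
  | _ k ih =>
  by_cases hfree : ∃ g ∈ relAut A, ∃ p : ℕ, p.Prime ∧ g ≠ 1 ∧ g ^ p = 1 ∧ ∀ x, g x ≠ x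
  · obtain ⟨g, hg, p, hp, hg1, hgp, hfix⟩ := hfree
    exact ⟨g, hg, hg1, isSemiregularElt_of_prime hp hgp hfix⟩
  push Not at hfree
  have hcauchy : ∀ p : ℕ, p.Prime → p ∣ Nat.card (relAut A) →
      ∃ g ∈ relAut A, g ≠ 1 ∧ g ^ p = 1 ∧ ∃ x, g x = x := by
    intro p hp hdvd
    have : Fact p.Prime := ⟨hp⟩
    obtain ⟨g, hg⟩ := exists_prime_orderOf_dvd_card' p hdvd
    have hg1 : g.1 ≠ 1 := fun hg1 => hp.one_lt.ne (by
      rw [← hg, Subtype.ext (a1 := g) (a2 := 1) hg1, orderOf_one])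
    have hgp : g.1 ^ p = 1 := by
      rw [← hg]
      exact congrArg Subtype.val (pow_orderOf_eq_one g)
    exact ⟨g, g.2, hg1, hgp, hfree g g.2 p hp hg1 hgp⟩
  obtain ⟨a, b, hab⟩ : ∃ a b, Nat.card (relAut A) = 2 ^ a * 3 ^ b := by
    refine exists_eq_two_pow_mul_three_pow Nat.card_pos.ne' fun p hp hdvd => ?_
    obtain ⟨g, hg, hg1, hgp, x, hx⟩ := hcauchy p hp hdvd
    exact h.prime_eq_two_or_three hg hg1 hp hgp hx
  have hnt : Nontrivial (relAut A) := by
    obtain ⟨u, v, huv⟩ := h.exists_arc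
    obtain ⟨g, hg, rfl⟩ := h.vertexTransitive u v
    refine ⟨⟨g, hg⟩, 1, fun hg1 => ?_⟩
    have hg1' : g = 1 := congrArg Subtype.val hg1
    subst hg1'
    exact h.asymm _ _ huv huv
  by_cases h3 : 3 ∣ Nat.card (relAut A)
  swap
  · have hb : b = 0 := by
      by_contra hb
      exact h3 (hab ▸ (dvd_pow_self 3 hb).mul_left _)
    have hcard : Nat.card (relAut A) = 2 ^ a := by rw [hab, hb, pow_zero, mul_one]
    have : Fact (Nat.Prime 2) := ⟨Nat.prime_two⟩
    have hc := (IsPGroup.of_card hcard).center_nontrivial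
    obtain ⟨⟨z, hz⟩, hz1⟩ := exists_ne (1 : Subgroup.center (relAut A))
    refine ⟨z.1, z.2, fun he => hz1 (Subtype.ext (Subtype.ext he)), ?_⟩
    refine isSemiregularElt_of_commute fun u v => ?_
    obtain ⟨g, hg, hgu⟩ := h.vertexTransitive u v
    exact ⟨g, congrArg Subtype.val (Subgroup.mem_center_iff.1 hz ⟨g, hg⟩), hgu⟩
  have hT : ∀ v x y z, A v x → A v y → A v z → y ≠ x → z ≠ x →
      ∃ k ∈ relAut A, k v = v ∧ k x = x ∧ k y = z := by
    obtain ⟨g, hg, hg1, hg3, v₀, hv₀⟩ := hcauchy 3 Nat.prime_three h3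
    intro v x y z hx hy hz hyx hzx
    exact h.exists_fix_arc_apply_eq hg hg1 hg3 hv₀ hx hy hz hyx hzx
  have hsolv : Group.IsSolvable (relAut A) :=
    isSolvable_of_card_eq_prime_pow_mul_prime_pow Nat.prime_two Nat.prime_three _ ⟨a, b, hab⟩
  obtain ⟨M, hM, hM1, hMcomm⟩ := exists_normal_abelian_ne_bot (relAut A)
  let N := M.map (relAut A).subtype
  have hNA : N ≤ relAut A := Subgroup.map_subtype_le M
  have hNn : ∀ g ∈ relAut A, ∀ n ∈ N, g * n * g⁻¹ ∈ N := by
    rintro g hg _ ⟨n, hn, rfl⟩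
    exact ⟨⟨g, hg⟩ * n * ⟨g, hg⟩⁻¹, hM.conj_mem n hn _, rfl⟩
  have hcomm : ∀ m ∈ N, ∀ n ∈ N, m * n = n * m := by
    rintro _ ⟨m, hm, rfl⟩ _ ⟨n, hn, rfl⟩
    exact congrArg Subtype.val (hMcomm m hm n hn)
  obtain ⟨n, hn, hn1⟩ : ∃ n ∈ N, n ≠ 1 := by
    obtain ⟨n, hn⟩ := Subgroup.ne_bot_iff_exists_ne_one.1 hM1
    exact ⟨n.1.1, ⟨n.1, n.2, rfl⟩, fun he => hn (Subtype.ext (Subtype.ext he))⟩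
  by_cases hs : IsSemiregularElt V n
  · exact ⟨_, hNA hn, hn1, hs⟩
  unfold IsSemiregularElt at hs
  push Not at hs
  obtain ⟨j, ⟨x, hx⟩, hj⟩ := hs
  have hjN : n ^ j ∈ N := zpow_mem hn j
  refine hasSemiregularAut_of_lineDigraph h (h.out_eq_of_common_out hNA hNn hcomm
    fun v y z hy hz => h.exists_mem_fix_apply_eq hT hNn hjN (hNA hjN) hj hx hy hz) ?_
  intro W _ B hB hlt
  exact ih _ (hk ▸ hlt) hB rfl

/-- A finite connected asymmetric arc-transitive digraph of out-valence `4` has a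
non-identity semiregular automorphism.  Here a digraph on the (finite, non-empty)
vertex set `V` is given by its arc relation `A`, an automorphism is a permutation of
`V` preserving `A`, and connectedness means that any two vertices are joined by a
walk in the symmetrisation of `A`. -/
theorem semiregular_of_asymmetric_arcTransitive_outvalence_four
    {V : Type*} [Fintype V] [Nonempty V] (A : V → V → Prop)
    (hasym : ∀ u v : V, A u v → ¬ A v u)
    (hconn : ∀ u v : V, Relation.ReflTransGen (fun a b => A a b ∨ A b a) u v)
    (harc : ∃ u v : V, A u v)
    (hat : ∀ u v u' v' : V, A u v → A u' v' →
      ∃ g : Equiv.Perm V, (∀ x y : V, A (g x) (g y) ↔ A x y) ∧ g u = u' ∧ g v = v')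
    (hval : ∀ v : V, {w : V | A v w}.ncard = 4) :
    ∃ g : Equiv.Perm V, (∀ x y : V, A (g x) (g y) ↔ A x y) ∧ g ≠ 1 ∧
      IsSemiregularElt V g := by
  obtain ⟨g, hg, hg1, hgs⟩ :=
    IsAsymmArcTransitiveFour.hasSemiregularAut ⟨hasym, hconn, harc, hat, hval⟩
  exact ⟨g, hg, hg1, hgs⟩
end
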